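/- The quasi-Trefftz space 𝕊_d = {(p,v) ∈ ℙ^d × (ℙ^{d-1})² : 𝒯_{d-2}(-Δp - (ω²/c²)p) = 0 and iωρ v = ∇p} has dimension 2d+1 as a complex vector space. -/

import Mathlib

open MvPolynomial Complex

/-- Partial derivative in direction `i` of a function on `ℝ × ℝ`. -/
noncomputable def pd (i : Fin 2) (f : ℝ × ℝ → ℂ) : ℝ × ℝ → ℂ :=
  fun x => fderiv ℝ f x (if i = 0 then ((1 : ℝ), (0 : ℝ)) else ((0 : ℝ), (1 : ℝ)))

/-- `taylorZero q f x₀` : the Taylor truncation of order `q` of `f` at `x₀` vanishes. -/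
noncomputable def taylorZero (q : ℕ) (f : ℝ × ℝ → ℂ) (x₀ : ℝ × ℝ) : Prop :=
  ∀ a b : ℕ, a + b ≤ q → (pd 0)^[a] ((pd 1)^[b] f) x₀ = 0

/-- Evaluation of a two-variable complex polynomial at a real point. -/
noncomputable def pev (p : MvPolynomial (Fin 2) ℂ) (x : ℝ × ℝ) : ℂ :=
  MvPolynomial.eval ![(x.1 : ℂ), (x.2 : ℂ)] p

open Filter Topology

/-- The mixed partial derivative `∂₀ᵃ ∂₁ᵇ f`. -/
noncomputable def mixedPd (a b : ℕ) (f : ℝ × ℝ → ℂ) : ℝ × ℝ → ℂ :=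
  (pd 0)^[a] ((pd 1)^[b] f)

/-- The Helmholtz-type operator `-Δp - q p` applied to a polynomial. -/
noncomputable def helmholtz (q : ℝ × ℝ → ℂ) (p : MvPolynomial (Fin 2) ℂ) : ℝ × ℝ → ℂ :=
  fun x => -(pd 0 (pd 0 (pev p)) x + pd 1 (pd 1 (pev p)) x) - q x * pev p x

theorem pd_congr (i : Fin 2) {f g : ℝ × ℝ → ℂ} {x : ℝ × ℝ} (h : f =ᶠ[𝓝 x] g) :
    pd i f =ᶠ[𝓝 x] pd i g := by
  filter_upwards [h.fderiv (𝕜 := ℝ)] with y hy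
  simp only [pd, hy]

theorem pd_iterate_congr (i : Fin 2) (n : ℕ) {f g : ℝ × ℝ → ℂ} {x : ℝ × ℝ} (h : f =ᶠ[𝓝 x] g) :
    (pd i)^[n] f =ᶠ[𝓝 x] (pd i)^[n] g := by
  induction n generalizing f g with
  | zero => exact h
  | succ n ih => exact ih (pd_congr i h)

theorem mixedPd_congr (a b : ℕ) {f g : ℝ × ℝ → ℂ} {x : ℝ × ℝ} (h : f =ᶠ[𝓝 x] g) :
    mixedPd a b f x = mixedPd a b g x :=
  (pd_iterate_congr 0 a (pd_iterate_congr 1 b h)).eq_of_nhds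

theorem ContDiffAt.pd {n : ℕ} {f : ℝ × ℝ → ℂ} {x : ℝ × ℝ} (i : Fin 2)
    (hf : ContDiffAt ℝ ((n + 1 : ℕ) : WithTop ℕ∞) f x) :
    ContDiffAt ℝ (n : WithTop ℕ∞) (pd i f) x :=
  (hf.fderiv_right (m := (n : WithTop ℕ∞)) (by push_cast; exact le_rfl)).clm_apply
    contDiffAt_const

theorem eventually_differentiableAt {n : ℕ} {f : ℝ × ℝ → ℂ} {x : ℝ × ℝ}
    (hf : ContDiffAt ℝ ((n + 1 : ℕ) : WithTop ℕ∞) f x) :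
    ∀ᶠ y in 𝓝 x, DifferentiableAt ℝ f y := by
  filter_upwards [hf.eventually (by simp)] with y hy
  exact hy.differentiableAt (by simp)

theorem pd_add_eventuallyEq {n : ℕ} {f g : ℝ × ℝ → ℂ} {x : ℝ × ℝ} (i : Fin 2)
    (hf : ContDiffAt ℝ ((n + 1 : ℕ) : WithTop ℕ∞) f x)
    (hg : ContDiffAt ℝ ((n + 1 : ℕ) : WithTop ℕ∞) g x) :
    pd i (f + g) =ᶠ[𝓝 x] pd i f + pd i g := by
  filter_upwards [eventually_differentiableAt hf, eventually_differentiableAt hg] with y h₁ h₂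
  simp [pd, fderiv_add h₁ h₂]

theorem pd_mul_eventuallyEq {n : ℕ} {f g : ℝ × ℝ → ℂ} {x : ℝ × ℝ} (i : Fin 2)
    (hf : ContDiffAt ℝ ((n + 1 : ℕ) : WithTop ℕ∞) f x)
    (hg : ContDiffAt ℝ ((n + 1 : ℕ) : WithTop ℕ∞) g x) :
    pd i (f * g) =ᶠ[𝓝 x] f * pd i g + pd i f * g := by
  filter_upwards [eventually_differentiableAt hf, eventually_differentiableAt hg] with y h₁ h₂
  simp [pd, fderiv_mul h₁ h₂, mul_comm (g y)]

theorem mixedPd_add {a b n : ℕ} (hn : a + b ≤ n) {f g : ℝ × ℝ → ℂ} {x : ℝ × ℝ}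
    (hf : ContDiffAt ℝ (n : WithTop ℕ∞) f x) (hg : ContDiffAt ℝ (n : WithTop ℕ∞) g x) :
    mixedPd a b (f + g) x = mixedPd a b f x + mixedPd a b g x := by
  induction n generalizing a b f g with
  | zero =>
    obtain ⟨rfl, rfl⟩ : a = 0 ∧ b = 0 := by omega
    rfl
  | succ n ih =>
    cases b with
    | succ b =>
      change mixedPd a b (pd 1 (f + g)) x = mixedPd a b (pd 1 f) x + mixedPd a b (pd 1 g) x
      rw [mixedPd_congr a b (pd_add_eventuallyEq 1 hf hg)]
      exact ih (by omega) (hf.pd 1) (hg.pd 1)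
    | zero =>
      cases a with
      | zero => rfl
      | succ a =>
        change mixedPd a 0 (pd 0 (f + g)) x = mixedPd a 0 (pd 0 f) x + mixedPd a 0 (pd 0 g) x
        rw [mixedPd_congr a 0 (pd_add_eventuallyEq 0 hf hg)]
        exact ih (by omega) (hf.pd 0) (hg.pd 0)

theorem pd_smul (i : Fin 2) (r : ℂ) (f : ℝ × ℝ → ℂ) : pd i (r • f) = r • pd i f := by
  funext x
  simp [pd, fderiv_const_smul_field]

theorem pd_iterate_smul (i : Fin 2) (n : ℕ) (r : ℂ) (f : ℝ × ℝ → ℂ) :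
    (pd i)^[n] (r • f) = r • (pd i)^[n] f := by
  induction n generalizing f with
  | zero => rfl
  | succ n ih => simp only [Function.iterate_succ_apply, pd_smul, ih]

theorem mixedPd_smul (a b : ℕ) (r : ℂ) (f : ℝ × ℝ → ℂ) :
    mixedPd a b (r • f) = r • mixedPd a b f := by
  simp only [mixedPd, pd_iterate_smul]

theorem pev_add (p r : MvPolynomial (Fin 2) ℂ) : pev (p + r) = pev p + pev r := by
  funext x; simp [pev]

theorem pev_smul (z : ℂ) (p : MvPolynomial (Fin 2) ℂ) : pev (z • p) = z • pev p := by
  funext x; simp [pev]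

theorem pev_mul (p r : MvPolynomial (Fin 2) ℂ) : pev (p * r) = pev p * pev r := by
  funext x; simp [pev]

theorem pev_C (z : ℂ) : pev (C z) = fun _ => z := by
  funext x; simp [pev]

theorem pev_X (i : Fin 2) :
    pev (X i) = fun x => ((if i = 0 then x.1 else x.2 : ℝ) : ℂ) := by
  funext x; fin_cases i <;> simp [pev]

theorem contDiff_pev_X (i : Fin 2) {n : WithTop ℕ∞} : ContDiff ℝ n (pev (X i)) := by
  rw [pev_X]
  by_cases h : i = 0
  · simp only [h, if_true]
    exact Complex.ofRealCLM.contDiff.comp contDiff_fst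
  · simp only [h, if_false]
    exact Complex.ofRealCLM.contDiff.comp contDiff_snd

theorem contDiff_pev (p : MvPolynomial (Fin 2) ℂ) {n : WithTop ℕ∞} : ContDiff ℝ n (pev p) := by
  induction p using MvPolynomial.induction_on with
  | C z => rw [pev_C]; exact contDiff_const
  | add p r hp hr => rw [pev_add]; exact hp.add hr
  | mul_X p i hp => rw [pev_mul]; exact hp.mul (contDiff_pev_X i)

theorem differentiable_pev (p : MvPolynomial (Fin 2) ℂ) : Differentiable ℝ (pev p) :=
  (contDiff_pev p (n := 1)).differentiable (by simp)

theorem pd_pev_X (i j : Fin 2) : pd i (pev (X j)) = pev (pderiv i (X j)) := by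
  funext x
  rw [pev_X, pd]
  have h₁ : HasFDerivAt (fun y : ℝ × ℝ => (y.1 : ℂ))
      (Complex.ofRealCLM.comp (ContinuousLinearMap.fst ℝ ℝ ℝ)) x :=
    (Complex.ofRealCLM.comp (ContinuousLinearMap.fst ℝ ℝ ℝ)).hasFDerivAt
  have h₂ : HasFDerivAt (fun y : ℝ × ℝ => (y.2 : ℂ))
      (Complex.ofRealCLM.comp (ContinuousLinearMap.snd ℝ ℝ ℝ)) x :=
    (Complex.ofRealCLM.comp (ContinuousLinearMap.snd ℝ ℝ ℝ)).hasFDerivAt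
  fin_cases i <;> fin_cases j <;> simp [h₁.fderiv, h₂.fderiv, pev, pderiv_X]

theorem pd_pev (i : Fin 2) (p : MvPolynomial (Fin 2) ℂ) : pd i (pev p) = pev (pderiv i p) := by
  induction p using MvPolynomial.induction_on with
  | C z => funext x; simp [pev_C, pd, pev]
  | add p r hp hr =>
    rw [map_add, pev_add, pev_add, ← hp, ← hr]
    funext x
    simp [pd, fderiv_add (differentiable_pev p x) (differentiable_pev r x)]
  | mul_X p j hp =>
    rw [Derivation.leibniz, pev_add, smul_eq_mul, smul_eq_mul, pev_mul, pev_mul, pev_mul, ← hp,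
      ← pd_pev_X]
    funext x
    simp [pd, fderiv_mul (differentiable_pev p x) (differentiable_pev (X j) x)]

theorem pderiv_pderiv_comm {σ R : Type*} [CommRing R] (i j : σ) (p : MvPolynomial σ R) :
    pderiv i (pderiv j p) = pderiv j (pderiv i p) := by
  classical
  have h : ⁅pderiv (R := R) i, pderiv (R := R) j⁆ = 0 := by
    refine MvPolynomial.derivation_ext fun k => ?_
    simp [Derivation.commutator_apply, pderiv_X, Pi.single_apply, apply_ite]
  have h' := congrArg (fun D : Derivation R (MvPolynomial σ R) (MvPolynomial σ R) => D p) h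
  simpa [Derivation.commutator_apply, sub_eq_zero] using h'

theorem pd_iterate_pd_pev (b : ℕ) (p : MvPolynomial (Fin 2) ℂ) :
    (pd 1)^[b] (pd 0 (pev p)) = pd 0 ((pd 1)^[b] (pev p)) := by
  induction b generalizing p with
  | zero => rfl
  | succ b ih =>
    rw [Function.iterate_succ_apply, Function.iterate_succ_apply, pd_pev 1 p, ← ih, pd_pev, pd_pev,
      pd_pev, pderiv_pderiv_comm]

theorem mixedPd_pd_zero_pev (a b : ℕ) (p : MvPolynomial (Fin 2) ℂ) :
    mixedPd a b (pd 0 (pev p)) = mixedPd (a + 1) b (pev p) := by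
  rw [mixedPd, pd_iterate_pd_pev]
  rfl

theorem mixedPd_pd_one (a b : ℕ) (f : ℝ × ℝ → ℂ) :
    mixedPd a b (pd 1 f) = mixedPd a (b + 1) f := rfl

theorem mixedPd_mul_pev_eq_zero {a b n : ℕ} (hn : a + b ≤ n) {q : ℝ × ℝ → ℂ} {x : ℝ × ℝ}
    (hq : ContDiffAt ℝ (n : WithTop ℕ∞) q x) {p : MvPolynomial (Fin 2) ℂ}
    (hp : ∀ a' ≤ a, ∀ b' ≤ b, mixedPd a' b' (pev p) x = 0) :
    mixedPd a b (q * pev p) x = 0 := by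
  induction n generalizing a b q p with
  | zero =>
    obtain ⟨rfl, rfl⟩ : a = 0 ∧ b = 0 := by omega
    have h := hp 0 le_rfl 0 le_rfl
    simp only [mixedPd, Function.iterate_zero, id_eq] at h
    simp [mixedPd, h]
  | succ n ih =>
    have hq' : ContDiffAt ℝ (n : WithTop ℕ∞) q x := hq.of_le (by exact_mod_cast n.le_succ)
    cases b with
    | succ b =>
      change mixedPd a b (pd 1 (q * pev p)) x = 0
      rw [mixedPd_congr a b (pd_mul_eventuallyEq 1 hq (contDiff_pev p).contDiffAt), pd_pev 1 p,
        mixedPd_add (f := q * pev (pderiv 1 p)) (g := pd 1 q * pev p) (n := n) (by omega)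
          (hq'.mul (contDiff_pev _).contDiffAt) ((hq.pd 1).mul (contDiff_pev _).contDiffAt),
        ih (by omega) hq' fun a' ha b' hb => by
          rw [← pd_pev, mixedPd_pd_one]
          exact hp a' ha (b' + 1) (by omega),
        ih (by omega) (hq.pd 1) fun a' ha b' hb => hp a' ha b' (by omega), add_zero]
    | zero =>
      cases a with
      | zero =>
        have h := hp 0 le_rfl 0 le_rfl
        simp only [mixedPd, Function.iterate_zero, id_eq] at h
        simp [mixedPd, h]
      | succ a =>
        change mixedPd a 0 (pd 0 (q * pev p)) x = 0
        rw [mixedPd_congr a 0 (pd_mul_eventuallyEq 0 hq (contDiff_pev p).contDiffAt), pd_pev 0 p,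
          mixedPd_add (f := q * pev (pderiv 0 p)) (g := pd 0 q * pev p) (n := n) (by omega)
            (hq'.mul (contDiff_pev _).contDiffAt) ((hq.pd 0).mul (contDiff_pev _).contDiffAt),
          ih (by omega) hq' fun a' ha b' hb => by
            rw [← pd_pev, mixedPd_pd_zero_pev]
            exact hp (a' + 1) (by omega) b' hb,
          ih (by omega) (hq.pd 0) fun a' ha b' hb => hp a' (by omega) b' hb, add_zero]

theorem totalDegree_pderiv_le {σ R : Type*} [CommSemiring R] (i : σ) (p : MvPolynomial σ R) :
    (pderiv i p).totalDegree ≤ p.totalDegree - 1 := by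
  refine Finset.sup_le fun m hm => ?_
  rw [mem_support_iff, coeff_pderiv] at hm
  have h := le_totalDegree (mem_support_iff.2 (left_ne_zero_of_mul hm))
  rw [Finsupp.sum_add_index' (fun _ => rfl) (fun _ _ _ => rfl), Finsupp.sum_single_index rfl] at h
  omega

theorem eq_C_of_pderiv_eq_zero {σ R : Type*} [CommRing R] [IsDomain R] [CharZero R]
    {p : MvPolynomial σ R} (h : ∀ i, pderiv i p = 0) : p = C (coeff 0 p) := by
  classical
  ext m
  rw [coeff_C]
  split_ifs with hm
  · rw [hm]
  · obtain ⟨i, hi⟩ : ∃ i, m i ≠ 0 := by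
      by_contra! h0
      exact hm (Finsupp.ext fun i => (h0 i).symm)
    have hc := coeff_pderiv (i := i) p (m - Finsupp.single i 1)
    have hle : Finsupp.single i 1 ≤ m := by
      rw [Finsupp.single_le_iff]; omega
    rw [h i, coeff_zero, tsub_add_cancel_of_le hle] at hc
    exact (mul_eq_zero.1 hc.symm).resolve_right (Nat.cast_add_one_ne_zero _)

theorem eq_zero_of_mixedPd_pev_eq_zero {d : ℕ} {p : MvPolynomial (Fin 2) ℂ} {x : ℝ × ℝ}
    (hd : p.totalDegree ≤ d) (h : ∀ a b, a + b ≤ d → mixedPd a b (pev p) x = 0) : p = 0 := by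
  have key : p = C (coeff 0 p) → p = 0 := fun hC => by
    have h0 := h 0 0 (Nat.zero_le _)
    rw [hC] at h0 ⊢
    simpa [mixedPd, pev_C] using h0
  induction d generalizing p with
  | zero => exact key (totalDegree_eq_zero_iff_eq_C.1 (Nat.le_zero.1 hd))
  | succ d ih =>
    refine key (eq_C_of_pderiv_eq_zero fun i => ?_)
    have hdeg : (pderiv i p).totalDegree ≤ d := (totalDegree_pderiv_le i p).trans (by omega)
    have hder : ∀ a b, a + b ≤ d → mixedPd a b (pev (pderiv i p)) x = 0 := fun a b hab => by
      rw [← pd_pev]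
      fin_cases i
      · exact (congrFun (mixedPd_pd_zero_pev a b p) x).trans (h (a + 1) b (by omega))
      · exact h a (b + 1) (by omega)
    refine ih hdeg hder fun hC => ?_
    have h0 := hder 0 0 (Nat.zero_le _)
    rw [hC] at h0 ⊢
    simpa [mixedPd, pev_C] using h0

theorem helmholtz_eq (q : ℝ × ℝ → ℂ) (p : MvPolynomial (Fin 2) ℂ) :
    helmholtz q p = (-1 : ℂ) • pev (pderiv 0 (pderiv 0 p) + pderiv 1 (pderiv 1 p))
      + (-1 : ℂ) • (q * pev p) := by
  funext x
  simp only [helmholtz, pd_pev, pev_add, Pi.add_apply, Pi.smul_apply, Pi.mul_apply, smul_eq_mul]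
  ring

theorem contDiffAt_helmholtz {n : WithTop ℕ∞} {q : ℝ × ℝ → ℂ} {x : ℝ × ℝ}
    (hq : ContDiffAt ℝ n q x) (p : MvPolynomial (Fin 2) ℂ) :
    ContDiffAt ℝ n (helmholtz q p) x := by
  rw [helmholtz_eq]
  exact ((contDiff_pev _).contDiffAt.const_smul (-1 : ℂ)).add
    ((hq.mul (contDiff_pev p).contDiffAt).const_smul (-1 : ℂ))

theorem helmholtz_add (q : ℝ × ℝ → ℂ) (p r : MvPolynomial (Fin 2) ℂ) :
    helmholtz q (p + r) = helmholtz q p + helmholtz q r := by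
  funext x
  simp only [helmholtz_eq, map_add, pev_add, Pi.add_apply, Pi.smul_apply, Pi.mul_apply,
    smul_eq_mul]
  ring

theorem helmholtz_smul (q : ℝ × ℝ → ℂ) (z : ℂ) (p : MvPolynomial (Fin 2) ℂ) :
    helmholtz q (z • p) = z • helmholtz q p := by
  funext x
  simp only [helmholtz_eq, Derivation.map_smul, pev_add, pev_smul, Pi.add_apply, Pi.smul_apply,
    Pi.mul_apply, smul_eq_mul]
  ring

theorem mixedPd_helmholtz {a b n : ℕ} (hn : a + b ≤ n) {q : ℝ × ℝ → ℂ} {x : ℝ × ℝ}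
    (hq : ContDiffAt ℝ (n : WithTop ℕ∞) q x) (p : MvPolynomial (Fin 2) ℂ) :
    mixedPd a b (helmholtz q p) x =
      -(mixedPd (a + 2) b (pev p) x + mixedPd a (b + 2) (pev p) x)
        - mixedPd a b (q * pev p) x := by
  have h₁ : ContDiffAt ℝ (n : WithTop ℕ∞)
      ((-1 : ℂ) • pev (pderiv 0 (pderiv 0 p) + pderiv 1 (pderiv 1 p))) x :=
    (contDiff_pev _).contDiffAt.const_smul (-1 : ℂ)
  have h₂ : ContDiffAt ℝ (n : WithTop ℕ∞) ((-1 : ℂ) • (q * pev p)) x :=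
    (hq.mul (contDiff_pev p).contDiffAt).const_smul (-1 : ℂ)
  rw [helmholtz_eq, mixedPd_add hn h₁ h₂, mixedPd_smul, mixedPd_smul, Pi.smul_apply,
    Pi.smul_apply, pev_add, mixedPd_add hn (contDiff_pev _).contDiffAt (contDiff_pev _).contDiffAt,
    ← pd_pev 0, mixedPd_pd_zero_pev, ← pd_pev 0, mixedPd_pd_zero_pev, ← pd_pev 1, ← pd_pev 1,
    mixedPd_pd_one, mixedPd_pd_one]
  simp only [smul_eq_mul]
  ring

/-- Exponents of the monomials of total degree at most `d` in two variables. -/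
abbrev Exponents (d : ℕ) : Type := {m : Fin 2 →₀ ℕ | (m.sum fun _ e => e) ≤ d}

theorem Exponents.add_le {d : ℕ} (m : Exponents d) : m.1 0 + m.1 1 ≤ d := by
  have h : (m.1.sum fun _ e => e) ≤ d := m.2
  rwa [Finsupp.sum_fintype _ _ (fun _ => rfl), Fin.sum_univ_two] at h

/-- The exponent `(a, b)`. -/
noncomputable def Exponents.mk {d : ℕ} (a b : ℕ) (h : a + b ≤ d) : Exponents d :=
  ⟨Finsupp.equivFunOnFinite.symm ![a, b], by
    change (Finsupp.sum _ _) ≤ d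
    rw [Finsupp.sum_fintype _ _ (fun _ => rfl), Fin.sum_univ_two]
    simpa using h⟩

@[simp] theorem Exponents.mk_zero {d : ℕ} (a b : ℕ) (h : a + b ≤ d) :
    (Exponents.mk a b h).1 0 = a := by simp [Exponents.mk]

@[simp] theorem Exponents.mk_one {d : ℕ} (a b : ℕ) (h : a + b ≤ d) :
    (Exponents.mk a b h).1 1 = b := by simp [Exponents.mk]

theorem Exponents.ext {d : ℕ} {m m' : Exponents d} (h0 : m.1 0 = m'.1 0) (h1 : m.1 1 = m'.1 1) :
    m = m' := by
  refine Subtype.ext (Finsupp.ext fun i => ?_)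
  fin_cases i
  exacts [h0, h1]

instance Exponents.finite (d : ℕ) : Finite (Exponents d) := by
  refine Finite.of_injective
    (fun m : Exponents d => ((⟨m.1 0, by have := m.add_le; omega⟩ : Fin (d + 1)),
      (⟨m.1 1, by have := m.add_le; omega⟩ : Fin (d + 1)))) fun m m' h => ?_
  simp only [Prod.mk.injEq, Fin.mk.injEq] at h
  exact Exponents.ext h.1 h.2

/-- The Cauchy data of `p` on the line through `x` in direction `1` (the components with `m 0 ≤ 1`)
together with the derivatives at `x` of `-Δp - q p` up to order `d - 2`. -/
noncomputable def cauchyMap (d : ℕ) (x : ℝ × ℝ) (q : ℝ × ℝ → ℂ)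
    (hq : ContDiffAt ℝ ((d - 2 : ℕ) : WithTop ℕ∞) q x) :
    restrictTotalDegree (Fin 2) ℂ d →ₗ[ℂ] (Exponents d → ℂ) where
  toFun p m := if m.1 0 ≤ 1 then mixedPd (m.1 0) (m.1 1) (pev p.1) x
    else mixedPd (m.1 0 - 2) (m.1 1) (helmholtz q p.1) x
  map_add' p r := by
    funext m
    have hm := m.add_le
    simp only [Submodule.coe_add, Pi.add_apply]
    split_ifs with h
    · rw [pev_add, mixedPd_add le_rfl (contDiff_pev _).contDiffAt (contDiff_pev _).contDiffAt]
    · rw [helmholtz_add, mixedPd_add (n := d - 2) (by omega) (contDiffAt_helmholtz hq _)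
        (contDiffAt_helmholtz hq _)]
  map_smul' z p := by
    funext m
    simp only [Submodule.coe_smul, Pi.smul_apply, RingHom.id_apply]
    split_ifs with h
    · rw [pev_smul, mixedPd_smul, Pi.smul_apply]
    · rw [helmholtz_smul, mixedPd_smul, Pi.smul_apply]

section CauchyMap

variable {d : ℕ} {x : ℝ × ℝ} {q : ℝ × ℝ → ℂ}

theorem cauchyMap_apply_of_le (hq : ContDiffAt ℝ ((d - 2 : ℕ) : WithTop ℕ∞) q x)
    (p : restrictTotalDegree (Fin 2) ℂ d) {a b : ℕ} (h : a + b ≤ d) (ha : a ≤ 1) :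
    cauchyMap d x q hq p (Exponents.mk a b h) = mixedPd a b (pev p.1) x := by
  simp [cauchyMap, ha]

theorem cauchyMap_apply_add_two (hq : ContDiffAt ℝ ((d - 2 : ℕ) : WithTop ℕ∞) q x)
    (p : restrictTotalDegree (Fin 2) ℂ d) {a b : ℕ} (h : a + 2 + b ≤ d) :
    cauchyMap d x q hq p (Exponents.mk (a + 2) b h) = mixedPd a b (helmholtz q p.1) x := by
  simp [cauchyMap]

theorem cauchyMap_injective (hq : ContDiffAt ℝ ((d - 2 : ℕ) : WithTop ℕ∞) q x) :
    Function.Injective (cauchyMap d x q hq) := by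
  rw [← LinearMap.ker_eq_bot, LinearMap.ker_eq_bot']
  intro p hp
  suffices h : ∀ a b, a + b ≤ d → mixedPd a b (pev p.1) x = 0 from
    Subtype.ext (eq_zero_of_mixedPd_pev_eq_zero
      ((mem_restrictTotalDegree (Fin 2) d p.1).1 p.2) h)
  intro a
  induction a using Nat.strong_induction_on with
  | _ a ih =>
    intro b hab
    rcases Nat.lt_or_ge a 2 with ha | ha
    · rw [← cauchyMap_apply_of_le hq p hab (by omega), hp, Pi.zero_apply]
    · obtain ⟨a, rfl⟩ := Nat.exists_eq_add_of_le' ha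
      have h := cauchyMap_apply_add_two hq p hab
      rw [hp, Pi.zero_apply, mixedPd_helmholtz (n := d - 2) (by omega) hq,
        ih a (by omega) (b + 2) (by omega),
        mixedPd_mul_pev_eq_zero (n := d - 2) (by omega) hq
          fun a' ha' b' hb' => ih a' (by omega) b' (by omega)] at h
      simpa using h.symm

theorem cauchyMap_bijective (hq : ContDiffAt ℝ ((d - 2 : ℕ) : WithTop ℕ∞) q x) :
    Function.Bijective (cauchyMap d x q hq) := by
  have := Fintype.ofFinite (Exponents d)
  refine ⟨cauchyMap_injective hq,
    (LinearMap.injective_iff_surjective_of_finrank_eq_finrank ?_).1 (cauchyMap_injective hq)⟩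
  rw [Module.finrank_fintype_fun_eq_card]
  exact Module.finrank_eq_card_basis (basisRestrictSupport ℂ _)

theorem taylorZero_helmholtz_iff (hd : 2 ≤ d) (hq : ContDiffAt ℝ ((d - 2 : ℕ) : WithTop ℕ∞) q x)
    (p : restrictTotalDegree (Fin 2) ℂ d) :
    taylorZero (d - 2) (helmholtz q p.1) x ↔
      ∀ m : Exponents d, 2 ≤ m.1 0 → cauchyMap d x q hq p m = 0 := by
  constructor
  · intro h m hm
    have hle := m.add_le
    simp only [cauchyMap, LinearMap.coe_mk, AddHom.coe_mk, if_neg (show ¬ m.1 0 ≤ 1 by omega)]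
    exact h _ _ (by omega)
  · intro h a b hab
    have := h (Exponents.mk (a + 2) b (by omega)) (by simp)
    rwa [cauchyMap_apply_add_two] at this

end CauchyMap

/-- An enumeration of the exponents `(a, b)` with `a ≤ 1`. -/
noncomputable def cauchyExponent (d : ℕ) (k : Fin (2 * d + 1)) : Exponents d :=
  Exponents.mk (k % 2) (k / 2) (by omega)

theorem cauchyExponent_injective (d : ℕ) : Function.Injective (cauchyExponent d) := by
  intro k l h
  have h0 := congrArg (fun m : Exponents d => m.1 0) h
  have h1 := congrArg (fun m : Exponents d => m.1 1) h
  simp only [cauchyExponent, Exponents.mk_zero, Exponents.mk_one] at h0 h1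
  omega

theorem cauchyExponent_zero_le (d : ℕ) (k : Fin (2 * d + 1)) : (cauchyExponent d k).1 0 ≤ 1 := by
  simp only [cauchyExponent, Exponents.mk_zero]
  omega

theorem exists_cauchyExponent_eq {d : ℕ} {m : Exponents d} (hm : m.1 0 ≤ 1) :
    ∃ k, cauchyExponent d k = m := by
  have hle := m.add_le
  refine ⟨⟨2 * m.1 1 + m.1 0, by omega⟩, Exponents.ext ?_ ?_⟩ <;>
  · simp only [cauchyExponent, Exponents.mk_zero, Exponents.mk_one]
    omega

/-- The pressure-velocity pair `(p, κ⁻¹ ∇p)`. -/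
noncomputable def pressureVelocity (κ : ℂ) : MvPolynomial (Fin 2) ℂ →ₗ[ℂ]
    MvPolynomial (Fin 2) ℂ × MvPolynomial (Fin 2) ℂ × MvPolynomial (Fin 2) ℂ :=
  LinearMap.id.prod ((κ⁻¹ • (pderiv 0).toLinearMap).prod (κ⁻¹ • (pderiv 1).toLinearMap))

theorem C_mul_eq_iff {σ K : Type*} [Field K] {κ : K} (hκ : κ ≠ 0) (v g : MvPolynomial σ K) :
    C κ * v = g ↔ v = κ⁻¹ • g := by
  rw [C_mul', eq_inv_smul_iff₀ hκ]

/-- The quasi-Trefftz space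
`𝕊_d = {(p, v) ∈ ℙ^d × (ℙ^{d-1})² : 𝒯_{d-2}(-Δp - (ω²/c²)p) = 0, iωρ v = ∇p}`
has dimension `2d+1` over `ℂ`: it admits a linearly independent spanning family of
cardinality `2d+1`. -/
theorem quasiTrefftz_space_dimension
    (x₀ : ℝ × ℝ) (d : ℕ) (hd : 2 ≤ d)
    (ω ρ : ℝ) (hω : ω ≠ 0) (hρ : 0 < ρ)
    (c : ℝ × ℝ → ℝ) (hc : ContDiffAt ℝ (d - 2) c x₀) (hc0 : c x₀ ≠ 0) :
    ∃ b : Fin (2 * d + 1) →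
        MvPolynomial (Fin 2) ℂ × MvPolynomial (Fin 2) ℂ × MvPolynomial (Fin 2) ℂ,
      LinearIndependent ℂ b ∧
      (∀ i, b i ∈ {s : MvPolynomial (Fin 2) ℂ × MvPolynomial (Fin 2) ℂ ×
            MvPolynomial (Fin 2) ℂ |
          s.1.totalDegree ≤ d ∧ s.2.1.totalDegree ≤ d - 1 ∧ s.2.2.totalDegree ≤ d - 1 ∧
          taylorZero (d - 2)
            (fun x => -(pd 0 (pd 0 (pev s.1)) x + pd 1 (pd 1 (pev s.1)) x)
                - ((ω : ℂ) ^ 2 / (c x : ℂ) ^ 2) * pev s.1 x) x₀ ∧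
          C (Complex.I * ω * ρ) * s.2.1 = pderiv 0 s.1 ∧
          C (Complex.I * ω * ρ) * s.2.2 = pderiv 1 s.1}) ∧
      (∀ s ∈ {s : MvPolynomial (Fin 2) ℂ × MvPolynomial (Fin 2) ℂ ×
            MvPolynomial (Fin 2) ℂ |
          s.1.totalDegree ≤ d ∧ s.2.1.totalDegree ≤ d - 1 ∧ s.2.2.totalDegree ≤ d - 1 ∧
          taylorZero (d - 2)
            (fun x => -(pd 0 (pd 0 (pev s.1)) x + pd 1 (pd 1 (pev s.1)) x)
                - ((ω : ℂ) ^ 2 / (c x : ℂ) ^ 2) * pev s.1 x) x₀ ∧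
          C (Complex.I * ω * ρ) * s.2.1 = pderiv 0 s.1 ∧
          C (Complex.I * ω * ρ) * s.2.2 = pderiv 1 s.1},
        s ∈ Submodule.span ℂ (Set.range b)) := by
  set κ : ℂ := Complex.I * ω * ρ with hκ
  have hκ0 : κ ≠ 0 := by simp [hκ, hω, hρ.ne']
  set q : ℝ × ℝ → ℂ := fun x => (ω : ℂ) ^ 2 / (c x : ℂ) ^ 2
  have hq : ContDiffAt ℝ ((d - 2 : ℕ) : WithTop ℕ∞) q x₀ := by
    have hc' : ContDiffAt ℝ ((d - 2 : ℕ) : WithTop ℕ∞) (fun x => (c x : ℂ)) x₀ :=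
      Complex.ofRealCLM.contDiff.contDiffAt.comp x₀ hc
    simp only [q, div_eq_mul_inv]
    exact contDiffAt_const.mul ((hc'.pow 2).inv (by simpa using hc0))
  let Φ := LinearEquiv.ofBijective (cauchyMap d x₀ q hq) (cauchyMap_bijective hq)
  classical
  let P : Fin (2 * d + 1) → restrictTotalDegree (Fin 2) ℂ d :=
    fun k => Φ.symm (Pi.single (cauchyExponent d k) 1)
  have hΦP : ∀ k, cauchyMap d x₀ q hq (P k) = Pi.single (cauchyExponent d k) 1 :=
    fun k => Φ.apply_symm_apply _
  have hP : LinearIndependent ℂ P := by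
    refine LinearIndependent.map' (f := Φ.symm.toLinearMap) ?_ (LinearEquiv.ker _)
    exact (Pi.linearIndependent_single_one (Exponents d) ℂ).comp _ (cauchyExponent_injective d)
  let V := pressureVelocity κ ∘ₗ (restrictTotalDegree (Fin 2) ℂ d).subtype
  have hV : LinearMap.ker V = ⊥ := by
    rw [LinearMap.ker_eq_bot]
    intro p r h
    exact Subtype.ext (congrArg Prod.fst h)
  refine ⟨fun k => V (P k), hP.map' V hV, fun k => ?_, ?_⟩
  · have hdeg := (mem_restrictTotalDegree (Fin 2) d (P k).1).1 (P k).2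
    have hdeg' : ∀ i, (κ⁻¹ • pderiv i (P k).1).totalDegree ≤ d - 1 := fun i =>
      (totalDegree_smul_le _ _).trans ((totalDegree_pderiv_le _ _).trans (by omega))
    refine ⟨hdeg, hdeg' 0, hdeg' 1, (taylorZero_helmholtz_iff hd hq (P k)).2 fun m hm => ?_,
      (C_mul_eq_iff hκ0 _ _).2 rfl, (C_mul_eq_iff hκ0 _ _).2 rfl⟩
    rw [hΦP, Pi.single_eq_of_ne]
    rintro rfl
    have := cauchyExponent_zero_le d k
    omega
  · rintro ⟨p, v₀, v₁⟩ ⟨hdeg, -, -, hT, h0, h1⟩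
    let p' : restrictTotalDegree (Fin 2) ℂ d := ⟨p, (mem_restrictTotalDegree (Fin 2) d p).2 hdeg⟩
    have hs : (p, v₀, v₁) = V p' :=
      Prod.ext rfl (Prod.ext ((C_mul_eq_iff hκ0 _ _).1 h0) ((C_mul_eq_iff hκ0 _ _).1 h1))
    have hp' : p' = ∑ k, cauchyMap d x₀ q hq p' (cauchyExponent d k) • P k := by
      apply (cauchyMap_bijective hq).1
      rw [map_sum]
      simp only [map_smul, hΦP]
      funext m
      rw [Finset.sum_apply]
      rcases Nat.lt_or_ge 1 (m.1 0) with hm | hm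
      · rw [(taylorZero_helmholtz_iff hd hq p').1 hT m hm, Finset.sum_eq_zero]
        intro k _
        rw [Pi.smul_apply, Pi.single_eq_of_ne, smul_zero]
        rintro rfl
        have := cauchyExponent_zero_le d k
        omega
      · obtain ⟨k, rfl⟩ := exists_cauchyExponent_eq hm
        rw [Finset.sum_eq_single k]
        · simp
        · intro l _ hl
          rw [Pi.smul_apply, Pi.single_eq_of_ne ((cauchyExponent_injective d).ne hl.symm),
            smul_zero]
        · simp
    rw [hs, hp', map_sum]
    refine Submodule.sum_mem _ fun k _ => ?_
    rw [map_smul]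
    exact Submodule.smul_mem _ _ (Submodule.subset_span ⟨k, rfl⟩)
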